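/- Let f : M₁ → M₂ and g : M₂ → M₃ be smooth maps between locally finite-dimensional differential spaces. If f and g∘f are submersions and f is surjective, then g is a submersion. -/

import Mathlib

open scoped Topology

/-- A differential structure (in the sense of Sikorski and Aronszajn) on a topological space `M`:
a nonempty set of continuous complex-valued functions which separates points, is closed under
composition with infinitely `ℝ`-differentiable functions `ℂⁿ → ℂ`, and is local. -/
structure IsDiffStructure (M : Type*) [TopologicalSpace M] (D : Set (M → ℂ)) : Prop where
  nonempty : D.Nonempty
  continuous : ∀ f ∈ D, Continuous f
  separates : ∀ x y : M, x ≠ y → ∃ f ∈ D, f x ≠ f y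
  comp : ∀ (n : ℕ) (g : Fin n → (M → ℂ)), (∀ i, g i ∈ D) →
    ∀ F : (Fin n → ℂ) → ℂ, ContDiff ℝ (⊤ : ℕ∞) F → (fun x => F fun i => g i x) ∈ D
  locality : ∀ f : M → ℂ,
    (∀ x : M, ∃ U ∈ 𝓝 x, ∃ g ∈ D, ∀ y ∈ U, f y = g y) → f ∈ D

/-- The differential structure induced on a subset `A ⊆ M`: functions that locally (on `A`)
agree with elements of `D`. -/
def restrictD {M : Type*} [TopologicalSpace M] (D : Set (M → ℂ)) (A : Set M) :
    Set (A → ℂ) :=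
  {f | ∀ x : A, ∃ U : Set M, IsOpen U ∧ (x : M) ∈ U ∧
    ∃ g ∈ D, ∀ y : A, (y : M) ∈ U → f y = g y}

/-- The differential structure generated by a family `F` of functions: all functions which
locally agree with some smooth composite `G ∘ (g₁, …, gₙ)` of members of `F`. -/
def generatedD {M : Type*} [TopologicalSpace M] (F : Set (M → ℂ)) : Set (M → ℂ) :=
  {f | ∀ x : M, ∃ U ∈ 𝓝 x, ∃ (n : ℕ) (g : Fin n → (M → ℂ)), (∀ i, g i ∈ F) ∧
    ∃ G : (Fin n → ℂ) → ℂ, ContDiff ℝ (⊤ : ℕ∞) G ∧ ∀ y ∈ U, f y = G fun i => g i y}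

/-- The product differential structure on `M₁ × M₂`. -/
def prodD {M₁ M₂ : Type*} [TopologicalSpace M₁] [TopologicalSpace M₂]
    (D₁ : Set (M₁ → ℂ)) (D₂ : Set (M₂ → ℂ)) : Set (M₁ × M₂ → ℂ) :=
  generatedD ((fun f => f ∘ Prod.fst) '' D₁ ∪ (fun f => f ∘ Prod.snd) '' D₂)

/-- The differential structure on `ℝⁿ`: all infinitely `ℝ`-differentiable functions to `ℂ`. -/
def euclD (n : ℕ) : Set ((Fin n → ℝ) → ℂ) := {f | ContDiff ℝ (⊤ : ℕ∞) f}

/-- A map between spaces with differential structures is smooth if it pulls back structure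
functions to structure functions. -/
def DSmooth {M M' : Type*} (D : Set (M → ℂ)) (D' : Set (M' → ℂ)) (f : M → M') : Prop :=
  ∀ g ∈ D', (g ∘ f) ∈ D

/-- A diffeomorphism between spaces with differential structures: a smooth homeomorphism whose
inverse is smooth. -/
def IsDDiffeomorphism {M M' : Type*} [TopologicalSpace M] [TopologicalSpace M']
    (D : Set (M → ℂ)) (D' : Set (M' → ℂ)) (f : M → M') : Prop :=
  IsHomeomorph f ∧ DSmooth D D' f ∧ ∀ g ∈ D, ∃ h ∈ D', ∀ x, h (f x) = g x

/-- A closed smooth embedding: a closed topological embedding which is a diffeomorphism onto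
its image (with the restricted differential structure). -/
def IsClosedSmoothEmbedding {M M' : Type*} [TopologicalSpace M] [TopologicalSpace M']
    (D : Set (M → ℂ)) (D' : Set (M' → ℂ)) (f : M → M') : Prop :=
  Topology.IsClosedEmbedding f ∧
  (∀ h ∈ restrictD D' (Set.range f), (fun x => h ⟨f x, Set.mem_range_self x⟩) ∈ D) ∧
  (∀ g ∈ D, ∃ h ∈ restrictD D' (Set.range f), ∀ x, h ⟨f x, Set.mem_range_self x⟩ = g x)

/-- An open smooth embedding: an open topological embedding which is a diffeomorphism onto
its image (with the restricted differential structure). -/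
def IsOpenSmoothEmbedding {M M' : Type*} [TopologicalSpace M] [TopologicalSpace M']
    (D : Set (M → ℂ)) (D' : Set (M' → ℂ)) (f : M → M') : Prop :=
  Topology.IsOpenEmbedding f ∧
  (∀ h ∈ restrictD D' (Set.range f), (fun x => h ⟨f x, Set.mem_range_self x⟩) ∈ D) ∧
  (∀ g ∈ D, ∃ h ∈ restrictD D' (Set.range f), ∀ x, h ⟨f x, Set.mem_range_self x⟩ = g x)

/-- `f` is a local diffeomorphism at `x` if its restriction to some open neighborhood of `x`
is an open smooth embedding. -/
def IsLocalDiffeoAt {M M' : Type*} [TopologicalSpace M] [TopologicalSpace M']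
    (D : Set (M → ℂ)) (D' : Set (M' → ℂ)) (f : M → M') (x : M) : Prop :=
  ∃ U : Set M, IsOpen U ∧ x ∈ U ∧
    IsOpenSmoothEmbedding (restrictD D U) D' (fun y : U => f y)

/-- `f : M → M'` is a submersion at `x` if, together with some smooth `g : M → ℝⁿ`, the map
`y ↦ (f y, g y)` is a local diffeomorphism at `x`. -/
def DSubmersionAt {M M' : Type*} [TopologicalSpace M] [TopologicalSpace M']
    (D : Set (M → ℂ)) (D' : Set (M' → ℂ)) (f : M → M') (x : M) : Prop :=
  ∃ (n : ℕ) (g : M → (Fin n → ℝ)), DSmooth D (euclD n) g ∧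
    IsLocalDiffeoAt D (prodD D' (euclD n)) (fun y => (f y, g y)) x

/-- `f` is a submersion if it is a submersion at every point. -/
def DSubmersion {M M' : Type*} [TopologicalSpace M] [TopologicalSpace M']
    (D : Set (M → ℂ)) (D' : Set (M' → ℂ)) (f : M → M') : Prop :=
  ∀ x : M, DSubmersionAt D D' f x

/-- A differential space is locally finite-dimensional if every point has an open neighborhood
`U` on which finitely many smooth functions generate `C^∞(U)`. -/
def LocallyFinDimD {M : Type*} [TopologicalSpace M] (D : Set (M → ℂ)) : Prop :=
  ∀ x : M, ∃ U : Set M, IsOpen U ∧ x ∈ U ∧ ∃ (n : ℕ) (f : Fin n → (U → ℂ)),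
    (∀ i, f i ∈ restrictD D U) ∧ ∀ g ∈ restrictD D U, ∃ F : (Fin n → ℂ) → ℂ,
      ContDiff ℝ (⊤ : ℕ∞) F ∧ g = fun y => F fun i => f i y

section Helpers

open Filter

theorem IsDiffStructure.comp_fintype {M : Type*} [TopologicalSpace M] {D : Set (M → ℂ)}
    (hD : IsDiffStructure M D) {ι : Type} [Fintype ι] (u : ι → M → ℂ) (hu : ∀ i, u i ∈ D)
    (F : (ι → ℂ) → ℂ) (hF : ContDiff ℝ (⊤ : ℕ∞) F) : (fun x => F fun i => u i x) ∈ D := by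
  let e := Fintype.equivFin ι
  have h := hD.comp (Fintype.card ι) (fun k => u (e.symm k)) (fun k => hu _)
    (fun c => F fun i => c (e i)) (by fun_prop)
  simpa using h

theorem ofReal_apply_mem_euclD {n : ℕ} (j : Fin n) :
    (fun t : Fin n → ℝ => ((t j : ℝ) : ℂ)) ∈ euclD n := by
  change ContDiff ℝ (⊤ : ℕ∞) _
  exact Complex.ofRealCLM.contDiff.comp (contDiff_apply ℝ ℝ j)

/-- Every function in the product structure on `M × ℝⁿ` is locally a smooth function of finitely
many structure functions on `M` and of the coordinate in `ℝⁿ`. -/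
theorem exists_local_form_of_mem_prodD {M : Type*} [TopologicalSpace M] {D : Set (M → ℂ)}
    (hD : D.Nonempty) {n : ℕ} {K : M × (Fin n → ℝ) → ℂ} (hK : K ∈ prodD D (euclD n))
    (a : M × (Fin n → ℝ)) :
    ∃ (m : ℕ) (u : Fin m → M → ℂ), (∀ i, u i ∈ D) ∧
      ∃ κ : (Fin m → ℂ) × (Fin n → ℝ) → ℂ, ContDiff ℝ (⊤ : ℕ∞) κ ∧
        ∀ᶠ z in 𝓝 a, K z = κ (fun i => u i z.1, z.2) := by
  obtain ⟨U, hU, m, g, hg, G, hG, hKG⟩ := hK a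
  have key : ∀ i, ∃ u ∈ D, ∃ k : ℂ × (Fin n → ℝ) → ℂ, ContDiff ℝ (⊤ : ℕ∞) k ∧
      ∀ z : M × (Fin n → ℝ), g i z = k (u z.1, z.2) := by
    intro i
    rcases hg i with ⟨u, hu, h⟩ | ⟨v, hv, h⟩
    · exact ⟨u, hu, Prod.fst, contDiff_fst, fun z => by rw [← h]; rfl⟩
    · obtain ⟨u, hu⟩ := hD
      exact ⟨u, hu, fun c => v c.2, ContDiff.comp (g := v) hv contDiff_snd,
        fun z => by rw [← h]; rfl⟩
  choose u hu k hk hgk using key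
  refine ⟨m, u, hu, fun c => G fun i => k i (c.1 i, c.2), by fun_prop, ?_⟩
  filter_upwards [hU] with z hz
  rw [hKG z hz]
  simp only [hgk]

/-- A smooth function near a point of a finite-dimensional space has the same germ as a globally
smooth function. -/
theorem exists_contDiff_eventuallyEq {E : Type*} [NormedAddCommGroup E] [NormedSpace ℝ E]
    [FiniteDimensional ℝ E] {κ : E → ℂ} {a : E}
    (h : ∀ᶠ b in 𝓝 a, ContDiffAt ℝ (⊤ : ℕ∞) κ b) :
    ∃ κ' : E → ℂ, ContDiff ℝ (⊤ : ℕ∞) κ' ∧ κ =ᶠ[𝓝 a] κ' := by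
  obtain ⟨r, hr, hball⟩ := Metric.eventually_nhds_iff_ball.1 h
  let χ : ContDiffBump a := ⟨r / 4, r / 2, by positivity, by linarith⟩
  refine ⟨fun x => χ x • κ x, ?_, ?_⟩
  · rw [contDiff_iff_contDiffAt]
    intro x
    by_cases hx : x ∈ tsupport χ
    · rw [χ.tsupport_eq] at hx
      refine ContDiffAt.smul χ.contDiff.contDiffAt (hball x ?_)
      exact Metric.closedBall_subset_ball (by simp only [χ]; linarith) hx
    · have h0 := notMem_tsupport_iff_eventuallyEq.1 hx
      refine (contDiffAt_const (c := (0 : ℂ))).congr_of_eventuallyEq ?_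
      filter_upwards [h0] with y hy
      simp [hy]
  · filter_upwards [χ.eventuallyEq_one] with x hx
    simp [hx]

theorem exists_mem_prodD_eventuallyEq {M : Type*} [TopologicalSpace M] {D : Set (M → ℂ)}
    (hc : ∀ d ∈ D, Continuous d) {n : ℕ} {ι : Type} [Fintype ι] (u : ι → M → ℂ)
    (hu : ∀ i, u i ∈ D) (κ : (ι → ℂ) × (Fin n → ℝ) → ℂ) (a : M × (Fin n → ℝ))
    (hκ : ∀ᶠ b in 𝓝 ((fun i => u i a.1, a.2) : (ι → ℂ) × (Fin n → ℝ)),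
      ContDiffAt ℝ (⊤ : ℕ∞) κ b) :
    ∃ K ∈ prodD D (euclD n), ∀ᶠ z in 𝓝 a, κ (fun i => u i z.1, z.2) = K z := by
  obtain ⟨κ', hκ', heq⟩ := exists_contDiff_eventuallyEq hκ
  have hcont : Continuous fun z : M × (Fin n → ℝ) =>
      ((fun i => u i z.1, z.2) : (ι → ℂ) × (Fin n → ℝ)) :=
    (continuous_pi fun i => (hc _ (hu i)).comp continuous_fst).prodMk continuous_snd
  refine ⟨fun z => κ' (fun i => u i z.1, z.2), ?_, hcont.continuousAt.eventually heq⟩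
  intro z₀
  let e := Fintype.equivFin (ι ⊕ Fin n)
  let w : ι ⊕ Fin n → M × (Fin n → ℝ) → ℂ :=
    Sum.elim (fun i z => u i z.1) (fun j z => ((z.2 j : ℝ) : ℂ))
  refine ⟨Set.univ, univ_mem, Fintype.card (ι ⊕ Fin n), fun k => w (e.symm k), fun k => ?_,
    fun c => κ' (fun i => c (e (Sum.inl i)), fun j => (c (e (Sum.inr j))).re), ?_, ?_⟩
  · change w (e.symm k) ∈ _
    rcases e.symm k with i | j
    · exact Or.inl ⟨u i, hu i, rfl⟩
    · exact Or.inr ⟨_, ofReal_apply_mem_euclD j, rfl⟩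
  · refine hκ'.comp (ContDiff.prodMk (by fun_prop) (contDiff_pi.2 fun j => ?_))
    exact Complex.reCLM.contDiff.comp (contDiff_apply ℝ ℂ _)
  · intro y _
    simp [w]

theorem IsLocalDiffeoAt.exists_openPartialHomeomorph {M M' : Type*} [TopologicalSpace M]
    [TopologicalSpace M'] {D : Set (M → ℂ)} {D' : Set (M' → ℂ)} {α : M → M'} {x : M}
    (h : IsLocalDiffeoAt D D' α x) :
    ∃ e : OpenPartialHomeomorph M M', x ∈ e.source ∧ (∀ y ∈ e.source, e y = α y) ∧
      ∀ y ∈ e.source, ∀ d ∈ D, ∃ d' ∈ D', ∀ᶠ y' in 𝓝 y, d y' = d' (α y') := by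
  obtain ⟨U, hU, hx, hemb, -, hback⟩ := h
  have : Nonempty U := ⟨⟨x, hx⟩⟩
  let j := hU.isOpenEmbedding_subtypeVal.toOpenPartialHomeomorph (Subtype.val : U → M)
  let k := hemb.toOpenPartialHomeomorph
  have hsource : (j.symm.trans k).source = U := by
    simp [j, k]
  have hval : ∀ y ∈ (j.symm.trans k).source, (j.symm.trans k) y = α y := by
    intro y hy
    rw [hsource] at hy
    have : j.symm y = ⟨y, hy⟩ := j.left_inv (x := ⟨y, hy⟩) (by simp [j])
    simp [this, k]
  refine ⟨j.symm.trans k, by rw [hsource]; exact hx, hval, ?_⟩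
  intro y hy d hd
  have hyU : y ∈ U := hsource ▸ hy
  have hcont : ContinuousAt α y :=
    ((j.symm.trans k).continuousAt hy).congr
      (mem_of_superset ((j.symm.trans k).open_source.mem_nhds hy) hval)
  obtain ⟨h, hh, hhd⟩ := hback (fun z : U => d z)
    (fun z => ⟨Set.univ, isOpen_univ, trivial, d, hd, fun _ _ => rfl⟩)
  obtain ⟨V, hV, hyV, d', hd', hh'⟩ := hh ⟨α y, Set.mem_range_self (⟨y, hyU⟩ : U)⟩
  refine ⟨d', hd', ?_⟩
  filter_upwards [hcont (hV.mem_nhds hyV), hU.mem_nhds hyU] with y' hy'V hy'U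
  rw [← hhd ⟨y', hy'U⟩]
  exact hh' _ hy'V

theorem isLocalDiffeoAt_of_openPartialHomeomorph {M M' : Type*} [TopologicalSpace M]
    [TopologicalSpace M'] {D : Set (M → ℂ)} {D' : Set (M' → ℂ)} {α : M → M'} {x : M}
    (e : OpenPartialHomeomorph M M') (hx : x ∈ e.source) (he : ∀ y ∈ e.source, e y = α y)
    (hforth : ∀ y ∈ e.source, ∀ d' ∈ D', ∃ d ∈ D, ∀ᶠ y' in 𝓝 y, d' (α y') = d y')
    (hback : ∀ y ∈ e.source, ∀ d ∈ D, ∃ d' ∈ D', ∀ᶠ y' in 𝓝 y, d y' = d' (α y')) :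
    IsLocalDiffeoAt D D' α x := by
  have hcont : ∀ y ∈ e.source, ContinuousAt α y := fun y hy =>
    (e.continuousAt hy).congr (mem_of_superset (e.open_source.mem_nhds hy) he)
  have hemb : Topology.IsOpenEmbedding (fun y : e.source => α y) := by
    have h := e.open_target.isOpenEmbedding_subtypeVal.comp
      e.toHomeomorphSourceTarget.isOpenEmbedding
    convert h using 1
    funext y
    exact (he y y.2).symm
  refine ⟨e.source, e.open_source, hx, hemb, ?_, ?_⟩
  · intro h hh y
    obtain ⟨V, hV, hyV, d', hd', hhd'⟩ := hh ⟨α y, Set.mem_range_self y⟩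
    obtain ⟨d, hd, hdd'⟩ := hforth y y.2 d' hd'
    obtain ⟨W, hW, hWo, hyW⟩ := eventually_nhds_iff.1
      (hdd'.and ((hcont y y.2).eventually (hV.mem_nhds hyV)))
    refine ⟨W, hWo, hyW, d, hd, fun z hz => ?_⟩
    rw [← (hW z hz).1]
    exact hhd' _ (hW z hz).2
  · intro g hg
    have hinj := hemb.injective
    refine ⟨fun z => g z.2.choose, ?_, fun y => ?_⟩
    · rintro ⟨_, y, rfl⟩
      obtain ⟨V, hV, hyV, d, hd, hgd⟩ := hg y
      obtain ⟨d', hd', hdd'⟩ := hback y y.2 d hd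
      obtain ⟨W, hW, hWo, hyW⟩ := eventually_nhds_iff.1 (hdd'.and (hV.mem_nhds hyV))
      refine ⟨(fun y : e.source => α y) '' (Subtype.val ⁻¹' W),
        hemb.isOpenMap _ (hWo.preimage continuous_subtype_val), ⟨y, hyW, rfl⟩, d', hd', ?_⟩
      rintro z ⟨y', hy', hz⟩
      have hch : z.2.choose = y' := hinj (z.2.choose_spec.trans hz.symm)
      have h1 := hW y' hy'
      change g z.2.choose = d' z
      rw [hch, hgd y' h1.2, h1.1]
      exact congrArg d' hz
    · have hz : (fun y : e.source => α y) y ∈ Set.range fun y : e.source => α y :=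
        Set.mem_range_self y
      exact congrArg g (hinj hz.choose_spec)

/-- The inverse function theorem, with an inverse which is smooth on its whole domain. -/
theorem exists_openPartialHomeomorph_contDiffAt_symm {E F : Type*} [NormedAddCommGroup E]
    [NormedSpace ℝ E] [CompleteSpace E] [NormedAddCommGroup F] [NormedSpace ℝ F]
    {Ψ : E → F} (hΨ : ContDiff ℝ (⊤ : ℕ∞) Ψ) {a : E} (L : E ≃L[ℝ] F)
    (hL : HasFDerivAt Ψ (L : E →L[ℝ] F) a) :
    ∃ H : OpenPartialHomeomorph E F, a ∈ H.source ∧ (∀ x, H x = Ψ x) ∧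
      ∀ b ∈ H.target, ContDiffAt ℝ (⊤ : ℕ∞) H.symm b := by
  have hne : ((⊤ : ℕ∞) : WithTop ℕ∞) ≠ 0 := by simp
  let H₀ := hΨ.contDiffAt.toOpenPartialHomeomorph Ψ hL hne
  have ha : a ∈ H₀.source := hΨ.contDiffAt.mem_toOpenPartialHomeomorph_source hL hne
  have hcont : Continuous (fderiv ℝ Ψ) := hΨ.continuous_fderiv hne
  have hN : ∀ᶠ x in 𝓝 a, fderiv ℝ Ψ x ∈ Set.range ((↑) : (E ≃L[ℝ] F) → E →L[ℝ] F) := by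
    apply hcont.continuousAt.eventually
    rw [hL.fderiv]
    exact ContinuousLinearEquiv.nhds L
  obtain ⟨N, hN, hNo, haN⟩ := eventually_nhds_iff.1 hN
  refine ⟨H₀.restrOpen N hNo, ⟨ha, haN⟩, fun x => rfl, fun b hb => ?_⟩
  have hs := (H₀.restrOpen N hNo).map_target hb
  obtain ⟨L', hL'⟩ := hN _ hs.2
  refine (H₀.restrOpen N hNo).contDiffAt_symm hb (f₀' := L') ?_ hΨ.contDiffAt
  rw [hL']
  exact (hΨ.differentiable hne _).hasFDerivAt

/-- In a chart with values in `M' × ℝⁿ`, a smooth map to `ℝᵇ` is locally a smooth function of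
finitely many structure functions on `M'` and of the coordinate in `ℝⁿ`. -/
theorem DSmooth.exists_local_form {M M' : Type*} [TopologicalSpace M] [TopologicalSpace M']
    {D : Set (M → ℂ)} {D' : Set (M' → ℂ)} (hD' : D'.Nonempty) {n b : ℕ}
    {f : M → M'} {φ : M → Fin n → ℝ} {ψ : M → Fin b → ℝ} {x : M}
    (hcont : ContinuousAt (fun y => (f y, φ y)) x) (hψ : DSmooth D (euclD b) ψ)
    (hfac : ∀ d ∈ D, ∃ d' ∈ prodD D' (euclD n), ∀ᶠ y in 𝓝 x, d y = d' (f y, φ y)) :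
    ∃ (ι : Type) (_ : Fintype ι) (u : ι → M' → ℂ), (∀ i, u i ∈ D') ∧
      ∃ κ : (ι → ℂ) × (Fin n → ℝ) → (Fin b → ℝ), ContDiff ℝ (⊤ : ℕ∞) κ ∧
        ∀ᶠ y in 𝓝 x, ψ y = κ (fun i => u i (f y), φ y) := by
  have key : ∀ j : Fin b, ∃ (m : ℕ) (u : Fin m → M' → ℂ), (∀ i, u i ∈ D') ∧
      ∃ κ : (Fin m → ℂ) × (Fin n → ℝ) → ℂ, ContDiff ℝ (⊤ : ℕ∞) κ ∧
        ∀ᶠ y in 𝓝 x, ((ψ y j : ℝ) : ℂ) = κ (fun i => u i (f y), φ y) := by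
    intro j
    obtain ⟨d', hd', h⟩ := hfac ((fun t : Fin b → ℝ => ((t j : ℝ) : ℂ)) ∘ ψ)
      (hψ _ (ofReal_apply_mem_euclD j))
    obtain ⟨m, u, hu, κ, hκ, hd'κ⟩ := exists_local_form_of_mem_prodD hD' hd' (f x, φ x)
    refine ⟨m, u, hu, κ, hκ, ?_⟩
    filter_upwards [h, hcont.eventually hd'κ] with y h1 h2
    exact h1.trans h2
  choose m u hu κ hκ hψκ using key
  refine ⟨Σ j, Fin (m j), inferInstance, fun i => u i.1 i.2, fun i => hu _ _,
    fun c j => (κ j (fun i => c.1 ⟨j, i⟩, c.2)).re, ?_, ?_⟩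
  · refine contDiff_pi.2 fun j => Complex.reCLM.contDiff.comp ((hκ j).comp ?_)
    fun_prop
  · filter_upwards [eventually_all.2 hψκ] with y hy
    funext j
    simp [← hy j]

/-- If `L : V → A` has a right inverse, then some linear map from `V` to a Euclidean space `ℝᶜ`
completes `L` to an isomorphism; consequently a smooth family `κ` of maps with derivative `L` in
the second variable can be straightened locally. -/
theorem exists_straightening {E V A : Type*} [NormedAddCommGroup E] [NormedSpace ℝ E]
    [FiniteDimensional ℝ E] [NormedAddCommGroup V] [NormedSpace ℝ V] [FiniteDimensional ℝ V]
    [NormedAddCommGroup A] [NormedSpace ℝ A] {κ : E × V → A} (hκ : ContDiff ℝ (⊤ : ℕ∞) κ)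
    (a : E × V) (R : A →L[ℝ] V)
    (hR : ∀ s, fderiv ℝ κ a (0, R s) = s) :
    ∃ (c : ℕ) (q : V →L[ℝ] (Fin c → ℝ)) (H : OpenPartialHomeomorph (E × V) (E × A × (Fin c → ℝ))),
      a ∈ H.source ∧ (∀ x, H x = (x.1, κ x, q x.2)) ∧
        ∀ b ∈ H.target, ContDiffAt ℝ (⊤ : ℕ∞) H.symm b := by
  let L : V →L[ℝ] A := (fderiv ℝ κ a).comp (ContinuousLinearMap.inr ℝ E V)
  let B : E →L[ℝ] A := (fderiv ℝ κ a).comp (ContinuousLinearMap.inl ℝ E V)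
  let e₀ := ContinuousLinearEquiv.equivOfRightInverse L R hR
  let k : L.ker ≃L[ℝ] (Fin (Module.finrank ℝ L.ker) → ℝ) :=
    ContinuousLinearEquiv.ofFinrankEq (by simp)
  let e : V ≃L[ℝ] A × (Fin (Module.finrank ℝ L.ker) → ℝ) :=
    e₀.trans ((ContinuousLinearEquiv.refl ℝ A).prodCongr k)
  let q : V →L[ℝ] (Fin (Module.finrank ℝ L.ker) → ℝ) :=
    (ContinuousLinearMap.snd ℝ A _).comp e.toContinuousLinearMap
  have he : ∀ v, e v = (L v, q v) := fun v => rfl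
  have hsplit : ∀ x : E × V, fderiv ℝ κ a x = B x.1 + L x.2 := by
    intro x
    simp only [B, L, ContinuousLinearMap.comp_apply, ← map_add]
    simp
  let T : E × V →L[ℝ] E × A × (Fin (Module.finrank ℝ L.ker) → ℝ) :=
    (ContinuousLinearMap.fst ℝ E V).prod
      ((fderiv ℝ κ a).prod (q.comp (ContinuousLinearMap.snd ℝ E V)))
  let S : E × A × (Fin (Module.finrank ℝ L.ker) → ℝ) →L[ℝ] E × V :=
    (ContinuousLinearMap.fst ℝ _ _).prod
      ((e.symm : _ →L[ℝ] V).comp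
        (ContinuousLinearMap.snd ℝ _ _ - (ContinuousLinearMap.inl ℝ A _).comp
          (B.comp (ContinuousLinearMap.fst ℝ _ _))))
  have hST : Function.LeftInverse S T := by
    rintro ⟨x, v⟩
    have : ((fderiv ℝ κ a (x, v), q v) : A × _) - (B x, 0) = e v := by
      rw [he, hsplit]; simp
    change (x, e.symm ((fderiv ℝ κ a (x, v), q v) - (B x, 0))) = (x, v)
    rw [this, e.symm_apply_apply]
  have hTS : Function.RightInverse S T := by
    rintro ⟨x, y, r⟩
    have h := he (e.symm ((y, r) - (B x, 0)))
    rw [e.apply_symm_apply] at h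
    have h1 := congrArg Prod.fst h
    have h2 := congrArg Prod.snd h
    simp only [Prod.fst_sub, Prod.snd_sub, sub_zero] at h1 h2
    change (x, fderiv ℝ κ a (x, e.symm ((y, r) - (B x, 0))), q (e.symm ((y, r) - (B x, 0)))) =
      (x, y, r)
    rw [hsplit, ← h2]
    simp only [← h1, add_sub_cancel]
  let TE := ContinuousLinearEquiv.equivOfInverse T S hST hTS
  have hne : ((⊤ : ℕ∞) : WithTop ℕ∞) ≠ 0 := by simp
  obtain ⟨H, haH, hH, hsymm⟩ := exists_openPartialHomeomorph_contDiffAt_symm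
    (Ψ := fun x : E × V => (x.1, κ x, q x.2)) (by fun_prop) (a := a) TE
    (hasFDerivAt_fst.prodMk ((hκ.differentiable hne a).hasFDerivAt.prodMk
      (q.hasFDerivAt.comp a hasFDerivAt_snd)))
  exact ⟨_, q, H, haH, hH, hsymm⟩

section Descent

variable {M₁ M₂ M₃ : Type*} [TopologicalSpace M₁] [TopologicalSpace M₂] [TopologicalSpace M₃]
  {D₁ : Set (M₁ → ℂ)} {D₂ : Set (M₂ → ℂ)} {D₃ : Set (M₃ → ℂ)} {f : M₁ → M₂} {g : M₂ → M₃}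
  {a b c : ℕ} {φ : M₁ → Fin a → ℝ} {ψ : M₁ → Fin b → ℝ}

/-- Given charts `(f, φ)` and `(g ∘ f, ψ)` of `M₁` with common domain `O`, and the coordinate
changes `κ`, `l` between them, a straightening of `κ` yields a chart of `M₂` over `M₃`. -/
theorem isLocalDiffeoAt_of_straightening
    (hD₂ : IsDiffStructure M₂ D₂) (hD₃ : IsDiffStructure M₃ D₃)
    (hf : DSmooth D₁ D₂ f) (hg : DSmooth D₂ D₃ g)
    (O : Set M₁) (e₁ : OpenPartialHomeomorph M₁ (M₂ × (Fin a → ℝ)))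
    (e₂ : OpenPartialHomeomorph M₁ (M₃ × (Fin b → ℝ)))
    (he₁O : e₁.source = O) (he₂O : e₂.source = O)
    (he₁ : ∀ x ∈ O, e₁ x = (f x, φ x)) (he₂ : ∀ x ∈ O, e₂ x = (g (f x), ψ x))
    (hfac : ∀ x ∈ O, ∀ d ∈ D₁, ∃ d' ∈ prodD D₃ (euclD b),
      ∀ᶠ y in 𝓝 x, d y = d' (g (f y), ψ y))
    {ι : Type} [Fintype ι] {u : ι → M₃ → ℂ} (hu : ∀ i, u i ∈ D₃)
    {κ : (ι → ℂ) × (Fin b → ℝ) → Fin a → ℝ}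
    (hκ : ∀ x ∈ O, φ x = κ (fun i => u i (g (f x)), ψ x))
    {ι' : Type} [Fintype ι'] {w : ι' → M₂ → ℂ} (hw : ∀ i, w i ∈ D₂)
    {l : (ι' → ℂ) × (Fin a → ℝ) → Fin b → ℝ} (hl : ContDiff ℝ (⊤ : ℕ∞) l)
    (hψl : ∀ x ∈ O, ψ x = l (fun i => w i (f x), φ x))
    (q : (Fin b → ℝ) →L[ℝ] (Fin c → ℝ))
    (H : OpenPartialHomeomorph ((ι → ℂ) × (Fin b → ℝ)) ((ι → ℂ) × (Fin a → ℝ) × (Fin c → ℝ)))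
    (hH : ∀ x, H x = (x.1, κ x, q x.2))
    (hHsymm : ∀ y ∈ H.target, ContDiffAt ℝ (⊤ : ℕ∞) H.symm y)
    (hOH : ∀ x ∈ O, ((fun i => u i (g (f x)), ψ x) : (ι → ℂ) × (Fin b → ℝ)) ∈ H.source)
    (x₁ : M₁) (hx₁ : x₁ ∈ O) :
    DSubmersionAt D₂ D₃ g (f x₁) := by
  subst he₁O
  set p := φ x₁ with hp
  let h : M₂ → Fin c → ℝ := fun y => q (l (fun i => w i y, p))
  let U : M₃ → ι → ℂ := fun z i => u i z
  let σ : M₃ × (Fin c → ℝ) → (ι → ℂ) × (Fin b → ℝ) := fun z => H.symm (U z.1, p, z.2)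
  have hUc : Continuous U := continuous_pi fun i => hD₃.continuous _ (hu i)
  have hhc : Continuous h := by
    have : Continuous fun y => ((fun i => w i y, p) : (ι' → ℂ) × (Fin a → ℝ)) :=
      (continuous_pi fun i => hD₂.continuous _ (hw i)).prodMk continuous_const
    exact q.continuous.comp (hl.continuous.comp this)
  have hh : DSmooth D₂ (euclD c) h := fun v hv =>
    hD₂.comp_fintype w hw (fun t => v (q (l (t, p))))
      (ContDiff.comp (g := v) hv (q.contDiff.comp (hl.comp (by fun_prop))))
  -- properties of the section `y ↦ e₁.symm (y, p)`
  have hsec : ∀ y, (y, p) ∈ e₁.target →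
      e₁.symm (y, p) ∈ e₁.source ∧ f (e₁.symm (y, p)) = y ∧ φ (e₁.symm (y, p)) = p := by
    intro y hy
    have hs := e₁.map_target hy
    have := (he₁ _ hs).symm.trans (e₁.right_inv hy)
    exact ⟨hs, congrArg Prod.fst this, congrArg Prod.snd this⟩
  have hψsec : ∀ y, (y, p) ∈ e₁.target → h y = q (ψ (e₁.symm (y, p))) := by
    intro y hy
    obtain ⟨hs, h1, h2⟩ := hsec y hy
    simp only [h, hψl _ hs, h1, h2]
  have hHsec : ∀ y, (y, p) ∈ e₁.target →
      (U (g y), p, h y) = H (U (g y), ψ (e₁.symm (y, p))) ∧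
        (U (g y), ψ (e₁.symm (y, p))) ∈ H.source := by
    intro y hy
    obtain ⟨hs, h1, h2⟩ := hsec y hy
    have h3 := hκ _ hs
    have h4 := hOH _ hs
    rw [h1] at h3 h4
    rw [h2] at h3
    refine ⟨?_, h4⟩
    rw [hH, hψsec y hy]
    exact Prod.ext rfl (Prod.ext h3 rfl)
  have hσsec : ∀ y, (y, p) ∈ e₁.target → σ (g y, h y) = (U (g y), ψ (e₁.symm (y, p))) := by
    intro y hy
    obtain ⟨h1, h2⟩ := hHsec y hy
    simp only [σ]
    rw [h1, H.left_inv h2]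
  have he₂sec : ∀ y, (y, p) ∈ e₁.target →
      e₂ (e₁.symm (y, p)) = (g y, ψ (e₁.symm (y, p))) := by
    intro y hy
    obtain ⟨hs, h1, h2⟩ := hsec y hy
    rw [he₂ _ hs, h1]
  -- properties of the candidate inverse
  have hinv : ∀ z : M₃ × (Fin c → ℝ), (U z.1, p, z.2) ∈ H.target → (z.1, (σ z).2) ∈ e₂.target →
      e₂.symm (z.1, (σ z).2) ∈ e₁.source ∧ g (f (e₂.symm (z.1, (σ z).2))) = z.1 ∧
        φ (e₂.symm (z.1, (σ z).2)) = p ∧ h (f (e₂.symm (z.1, (σ z).2))) = z.2 := by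
    intro z hz hz'
    have hs : e₂.symm (z.1, (σ z).2) ∈ e₁.source := he₂O ▸ e₂.map_target hz'
    have h1 := (he₂ _ hs).symm.trans (e₂.right_inv hz')
    have h2 : g (f (e₂.symm (z.1, (σ z).2))) = z.1 := congrArg Prod.fst h1
    have h3 : ψ (e₂.symm (z.1, (σ z).2)) = (σ z).2 := congrArg Prod.snd h1
    have h4 : ((σ z).1, κ (σ z), q (σ z).2) = (U z.1, p, z.2) :=
      (hH _).symm.trans (H.right_inv hz)
    have h5 : σ z = (U z.1, (σ z).2) := Prod.ext (congrArg (fun t => t.1) h4) rfl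
    have h6 : φ (e₂.symm (z.1, (σ z).2)) = p := by
      rw [hκ _ hs, h2, h3]
      change κ (U z.1, (σ z).2) = p
      rw [← h5]
      exact congrArg (fun t => t.2.1) h4
    refine ⟨hs, h2, h6, ?_⟩
    have h7 := hψl _ hs
    rw [h6, h3] at h7
    simp only [h]
    rw [← h7]
    exact congrArg (fun t => t.2.2) h4
  have hUpc : Continuous fun z : M₃ × (Fin c → ℝ) => (U z.1, p, z.2) :=
    (hUc.comp continuous_fst).prodMk (continuous_const.prodMk continuous_snd)
  have hσc : ContinuousOn (fun z => (z.1, (σ z).2))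
      ((fun z : M₃ × (Fin c → ℝ) => (U z.1, p, z.2)) ⁻¹' H.target) := by
    refine continuousOn_fst.prodMk (continuous_snd.comp_continuousOn ?_)
    exact H.continuousOn_symm.comp hUpc.continuousOn fun z hz => hz
  have hypc : Continuous fun y : M₂ => (y, p) := continuous_id.prodMk continuous_const
  have hsecc : ContinuousOn (fun y => e₁.symm (y, p)) ((fun y : M₂ => (y, p)) ⁻¹' e₁.target) :=
    e₁.continuousOn_symm.comp hypc.continuousOn fun y hy => hy
  have hfc : ContinuousOn f e₁.source :=
    (continuous_fst.comp_continuousOn e₁.continuousOn).congr fun x hx => by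
      simp [he₁ x hx]
  let e : OpenPartialHomeomorph M₂ (M₃ × (Fin c → ℝ)) :=
    { toFun := fun y => (g y, h y)
      invFun := fun z => f (e₂.symm (z.1, (σ z).2))
      source := (fun y : M₂ => (y, p)) ⁻¹' e₁.target
      target := (fun z : M₃ × (Fin c → ℝ) => (U z.1, p, z.2)) ⁻¹' H.target ∩
        (fun z => (z.1, (σ z).2)) ⁻¹' e₂.target
      map_source' := by
        intro y hy
        obtain ⟨h1, h2⟩ := hHsec y hy
        refine ⟨?_, ?_⟩
        · change (U (g y), p, h y) ∈ H.target
          rw [h1]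
          exact H.map_source h2
        · change (g y, (σ (g y, h y)).2) ∈ e₂.target
          rw [hσsec y hy]
          change (g y, ψ (e₁.symm (y, p))) ∈ e₂.target
          rw [← he₂sec y hy]
          exact e₂.map_source (he₂O ▸ (hsec y hy).1)
      map_target' := by
        intro z hz
        obtain ⟨h1, h2, h3, h4⟩ := hinv z hz.1 hz.2
        change (f (e₂.symm (z.1, (σ z).2)), p) ∈ e₁.target
        have := e₁.map_source h1
        rwa [he₁ _ h1, h3] at this
      left_inv' := by
        intro y hy
        change f (e₂.symm (g y, (σ (g y, h y)).2)) = y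
        rw [hσsec y hy]
        change f (e₂.symm (g y, ψ (e₁.symm (y, p)))) = y
        rw [← he₂sec y hy, e₂.left_inv (he₂O ▸ (hsec y hy).1)]
        exact (hsec y hy).2.1
      right_inv' := by
        intro z hz
        obtain ⟨h1, h2, h3, h4⟩ := hinv z hz.1 hz.2
        exact Prod.ext h2 h4
      open_source := e₁.open_target.preimage hypc
      open_target := hσc.isOpen_inter_preimage (H.open_target.preimage hUpc) e₂.open_target
      continuousOn_toFun := by
        refine ContinuousOn.prodMk ?_ hhc.continuousOn
        have h1 : ContinuousOn (fun y => (e₂ (e₁.symm (y, p))).1)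
            ((fun y : M₂ => (y, p)) ⁻¹' e₁.target) :=
          continuous_fst.comp_continuousOn
            (e₂.continuousOn.comp hsecc fun y hy => he₂O ▸ (hsec y hy).1)
        exact h1.congr fun y hy => by simp [he₂sec y hy]
      continuousOn_invFun := by
        refine hfc.comp (e₂.continuousOn_symm.comp (hσc.mono Set.inter_subset_left)
          fun z hz => hz.2) fun z hz => (hinv z hz.1 hz.2).1 }
  have hec : ∀ y ∈ e.source, ContinuousAt (fun y => (g y, h y)) y := fun y hy => e.continuousAt hy
  refine ⟨c, h, hh, isLocalDiffeoAt_of_openPartialHomeomorph e ?_ (fun y _ => rfl) ?_ ?_⟩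
  · change (f x₁, p) ∈ e₁.target
    rw [hp, ← he₁ x₁ hx₁]
    exact e₁.map_source hx₁
  · intro y hy d' hd'
    obtain ⟨N, hN, n, v, hv, G, hG, hd'G⟩ := hd' (g y, h y)
    refine ⟨fun y => G fun i => v i (g y, h y),
      hD₂.comp n (fun i y => v i (g y, h y)) (fun i => ?_) G hG, ?_⟩
    · rcases hv i with ⟨v₀, hv₀, hvi⟩ | ⟨v₀, hv₀, hvi⟩
      · rw [← hvi]
        exact hg _ hv₀
      · rw [← hvi]
        exact hh _ hv₀
    · filter_upwards [hec y hy hN] with y' hy'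
      exact hd'G _ hy'
  · intro y hy d hd
    have hx := (hsec y hy).1
    obtain ⟨K, hK, hdK⟩ := hfac _ hx _ (hf d hd)
    obtain ⟨m, v, hv, k, hk, hKk⟩ :=
      exists_local_form_of_mem_prodD hD₃.nonempty hK (g y, ψ (e₁.symm (y, p)))
    have hnear : ∀ᶠ y' in 𝓝 y, (y', p) ∈ e₁.target := e.open_source.mem_nhds hy
    have hsecy : ContinuousAt (fun y => e₁.symm (y, p)) y := hsecc.continuousAt hnear
    have hpair : ContinuousAt (fun y => (g y, ψ (e₁.symm (y, p)))) y := by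
      have h1 : ContinuousAt (fun y => e₂ (e₁.symm (y, p))) y :=
        ContinuousAt.comp (f := fun y => e₁.symm (y, p)) (e₂.continuousAt (he₂O ▸ hx)) hsecy
      exact h1.congr (hnear.mono he₂sec)
    have hsm : ∀ᶠ t in 𝓝 ((fun s => Sum.elim v u s (g y), h y) :
        (Fin m ⊕ ι → ℂ) × (Fin c → ℝ)), ContDiffAt ℝ (⊤ : ℕ∞)
          (fun t : (Fin m ⊕ ι → ℂ) × (Fin c → ℝ) =>
            k (fun i => t.1 (Sum.inl i), (H.symm (fun i => t.1 (Sum.inr i), p, t.2)).2)) t := by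
      have hmap : ContDiff ℝ (⊤ : ℕ∞) fun t : (Fin m ⊕ ι → ℂ) × (Fin c → ℝ) =>
          ((fun i => t.1 (Sum.inr i), p, t.2) : (ι → ℂ) × (Fin a → ℝ) × (Fin c → ℝ)) := by
        fun_prop
      have hmem : (U (g y), p, h y) ∈ H.target := (e.map_source hy).1
      filter_upwards [hmap.continuous.continuousAt.eventually (H.open_target.mem_nhds hmem)]
        with t ht
      refine hk.contDiffAt.comp t (ContDiffAt.prodMk (by fun_prop) ?_)
      exact contDiff_snd.contDiffAt.comp t
        (ContDiffAt.comp t (g := H.symm) (hHsymm _ ht) hmap.contDiffAt)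
    obtain ⟨d', hd', hkd'⟩ := exists_mem_prodD_eventuallyEq hD₃.continuous (Sum.elim v u)
      (by rintro (i | i); exacts [hv i, hu i]) _ (g y, h y) hsm
    refine ⟨d', hd', ?_⟩
    filter_upwards [hnear, hsecy.eventually hdK, hpair.eventually hKk, (hec y hy).eventually hkd']
      with y' h1 h2 h3 h4
    rw [← h4]
    obtain ⟨h5, h6, h7⟩ := hsec y' h1
    simp only [Function.comp_apply, h6] at h2
    rw [h2, h3]
    have h8 := congrArg Prod.snd (hσsec y' h1)
    change (H.symm (U (g y'), p, h y')).2 = ψ (e₁.symm (y', p)) at h8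
    rw [← h8]
    rfl

end Descent

end Helpers

/-- If `f : M₁ → M₂` and `g : M₂ → M₃` are smooth maps between locally finite-dimensional
differential spaces, `f` and `g ∘ f` are submersions, and `f` is surjective, then `g` is a
submersion. -/
theorem stmt_2
    {M₁ : Type*} [TopologicalSpace M₁] [T2Space M₁] [LocallyCompactSpace M₁]
    [SecondCountableTopology M₁]
    {M₂ : Type*} [TopologicalSpace M₂] [T2Space M₂] [LocallyCompactSpace M₂]
    [SecondCountableTopology M₂]
    {M₃ : Type*} [TopologicalSpace M₃] [T2Space M₃] [LocallyCompactSpace M₃]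
    [SecondCountableTopology M₃]
    (D₁ : Set (M₁ → ℂ)) (D₂ : Set (M₂ → ℂ)) (D₃ : Set (M₃ → ℂ))
    (hD₁ : IsDiffStructure M₁ D₁) (hD₂ : IsDiffStructure M₂ D₂) (hD₃ : IsDiffStructure M₃ D₃)
    (hfd₁ : LocallyFinDimD D₁) (hfd₂ : LocallyFinDimD D₂) (hfd₃ : LocallyFinDimD D₃)
    (f : M₁ → M₂) (g : M₂ → M₃) (hf : DSmooth D₁ D₂ f) (hg : DSmooth D₂ D₃ g)
    (hfsub : DSubmersion D₁ D₂ f) (hgfsub : DSubmersion D₁ D₃ (g ∘ f))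
    (hsurj : Function.Surjective f) :
    DSubmersion D₂ D₃ g := by
  intro x₂
  obtain ⟨x₁, rfl⟩ := hsurj x₂
  obtain ⟨a, φ, hφ, hloc₁⟩ := hfsub x₁
  obtain ⟨b, ψ, hψ, hloc₂⟩ := hgfsub x₁
  obtain ⟨e₁, hx₁, he₁, hfac₁⟩ := hloc₁.exists_openPartialHomeomorph
  obtain ⟨e₂, hx₂, he₂, hfac₂⟩ := hloc₂.exists_openPartialHomeomorph
  have hc₁ : ContinuousAt (fun y => (f y, φ y)) x₁ :=
    (e₁.continuousAt hx₁).congr (Filter.mem_of_superset (e₁.open_source.mem_nhds hx₁) he₁)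
  have hc₂ : ContinuousAt (fun y => ((g ∘ f) y, ψ y)) x₁ :=
    (e₂.continuousAt hx₂).congr (Filter.mem_of_superset (e₂.open_source.mem_nhds hx₂) he₂)
  obtain ⟨ι, _, u, hu, κ, hκ, hφκ⟩ :=
    hφ.exists_local_form hD₃.nonempty hc₂ (hfac₂ x₁ hx₂)
  obtain ⟨ι', _, w, hw, l, hl, hψl⟩ :=
    hψ.exists_local_form hD₂.nonempty hc₁ (hfac₁ x₁ hx₁)
  have hne : ((⊤ : ℕ∞) : WithTop ℕ∞) ≠ 0 := by simp
  set A : (ι → ℂ) × (Fin b → ℝ) := (fun i => u i (g (f x₁)), ψ x₁) with hA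
  have hid : (fun s : Fin a → ℝ => κ (fun i => u i (g (f x₁)), l (fun i => w i (f x₁), s)))
      =ᶠ[𝓝 (φ x₁)] id := by
    have hmem : (f x₁, φ x₁) ∈ e₁.target := he₁ x₁ hx₁ ▸ e₁.map_source hx₁
    have hsymm : e₁.symm (f x₁, φ x₁) = x₁ := by
      rw [← he₁ x₁ hx₁]
      exact e₁.left_inv hx₁
    have hpc : Continuous fun s : Fin a → ℝ => (f x₁, s) := continuous_const.prodMk continuous_id
    have hsc : Filter.Tendsto (fun s => e₁.symm (f x₁, s)) (𝓝 (φ x₁)) (𝓝 x₁) := by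
      have := ContinuousAt.comp (f := fun s : Fin a → ℝ => (f x₁, s)) (x := φ x₁)
        (e₁.continuousAt_symm hmem) hpc.continuousAt
      rw [ContinuousAt, Function.comp_apply, hsymm] at this
      exact this
    filter_upwards [hpc.continuousAt.eventually (e₁.open_target.mem_nhds hmem),
      hsc.eventually hφκ, hsc.eventually hψl] with s h1 h2 h3
    have h4 := (he₁ _ (e₁.map_target h1)).symm.trans (e₁.right_inv h1)
    have h5 : f (e₁.symm (f x₁, s)) = f x₁ := congrArg Prod.fst h4
    have h6 : φ (e₁.symm (f x₁, s)) = s := congrArg Prod.snd h4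
    simp only [Function.comp_apply, h5, h6] at h2 h3
    rw [h3] at h2
    exact h2.symm
  have hA' : A = (fun i => u i (g (f x₁)), l (fun i => w i (f x₁), φ x₁)) := by
    rw [hA, ← hψl.self_of_nhds]
  have hdl : DifferentiableAt ℝ (fun s : Fin a → ℝ => l (fun i => w i (f x₁), s)) (φ x₁) :=
    (hl.differentiable hne).differentiableAt.comp _ (by fun_prop)
  have hcomp : HasFDerivAt
      (fun s : Fin a → ℝ => κ (fun i => u i (g (f x₁)), l (fun i => w i (f x₁), s)))
      ((fderiv ℝ κ A).comp (ContinuousLinearMap.prod 0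
        (fderiv ℝ (fun s : Fin a → ℝ => l (fun i => w i (f x₁), s)) (φ x₁)))) (φ x₁) := by
    have h1 : HasFDerivAt κ (fderiv ℝ κ A)
        (fun i => u i (g (f x₁)), l (fun i => w i (f x₁), φ x₁)) :=
      hA' ▸ (hκ.differentiable hne A).hasFDerivAt
    exact h1.comp (φ x₁) ((hasFDerivAt_const _ _).prodMk hdl.hasFDerivAt)
  have hR := hcomp.unique ((hasFDerivAt_id (φ x₁)).congr_of_eventuallyEq hid)
  obtain ⟨c, q, H, hAH, hH, hHsymm⟩ := exists_straightening hκ A _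
    (fun s => by simpa using DFunLike.congr_fun hR s)
  have hAc : ContinuousAt (fun x => ((fun i => u i (g (f x)), ψ x) :
      (ι → ℂ) × (Fin b → ℝ))) x₁ := by
    have h1 : Continuous fun z : M₃ × (Fin b → ℝ) =>
        ((fun i => u i z.1, z.2) : (ι → ℂ) × (Fin b → ℝ)) :=
      (continuous_pi fun i => (hD₃.continuous _ (hu i)).comp continuous_fst).prodMk continuous_snd
    exact ContinuousAt.comp (g := fun z : M₃ × (Fin b → ℝ) =>
      ((fun i => u i z.1, z.2) : (ι → ℂ) × (Fin b → ℝ))) h1.continuousAt hc₂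
  obtain ⟨N, hN, hNo, hxN⟩ := eventually_nhds_iff.1
    ((hφκ.and hψl).and (hAc.eventually (H.open_source.mem_nhds hAH)))
  refine isLocalDiffeoAt_of_straightening hD₂ hD₃ hf hg (e₁.source ∩ (e₂.source ∩ N))
    (e₁.restrOpen (e₂.source ∩ N) (e₂.open_source.inter hNo))
    (e₂.restrOpen (e₁.source ∩ N) (e₁.open_source.inter hNo)) rfl
    (Set.inter_left_comm _ _ _) (fun x hx => he₁ x hx.1) (fun x hx => he₂ x hx.2.1)
    (fun x hx => hfac₂ x hx.2.1) hu (fun x hx => (hN x hx.2.2).1.1) hw hl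
    (fun x hx => (hN x hx.2.2).1.2) q H hH hHsymm (fun x hx => (hN x hx.2.2).2)
    x₁ ⟨hx₁, hx₂, hxN⟩
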